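/- For all non-negative integers m and n, D*_q(n,m) = ∑_{k=0}^{m} q^{(m-k)(n-k)} [m choose k]_q [n choose k]_q (-q;q)_k, as an identity of polynomials in q. -/

import Mathlib

open Finset

/-- The q-Pochhammer symbol `(a;q)_n = ∏_{j=0}^{n-1} (1 - a q^j)`. -/
noncomputable def qPoch {F : Type*} [Field F] (q a : F) (n : ℕ) : F :=
  ∏ j ∈ Finset.range n, (1 - a * q ^ j)

/-- The q-binomial coefficient `[n choose k]_q`, which is
`(q;q)_n / ((q;q)_k (q;q)_{n-k})` for `0 ≤ k ≤ n` and `0` otherwise. -/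
noncomputable def qBin {F : Type*} [Field F] (q : F) (n k : ℕ) : F :=
  if k ≤ n then qPoch q q n / (qPoch q q k * qPoch q q (n - k)) else 0

/-- The q-Delannoy number `D_q(m,n) = ∑_{k=0}^n q^{k(k-1)/2} [n,k]_q [n+m-k,n]_q`. -/
noncomputable def Dq {F : Type*} [Field F] (q : F) (m n : ℕ) : F :=
  ∑ k ∈ Finset.range (n + 1), q ^ (k * (k - 1) / 2) * qBin q n k * qBin q (n + m - k) n

/-- The q-Delannoy number of the second kind
`D*_q(m,n) = ∑_{k=0}^n q^{k(k+1)/2} [n,k]_q [n+m-k,n]_q`. -/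
noncomputable def Dstar {F : Type*} [Field F] (q : F) (m n : ℕ) : F :=
  ∑ k ∈ Finset.range (n + 1), q ^ (k * (k + 1) / 2) * qBin q n k * qBin q (n + m - k) n

/-- The field of rational functions `ℚ(q)`. -/
abbrev Fq : Type := FractionRing (Polynomial ℚ)

noncomputable def q : Fq := algebraMap (Polynomial ℚ) Fq Polynomial.X

lemma aux_q_ne : q ≠ 0 := by
  unfold q
  exact (map_ne_zero_iff _ (IsFractionRing.injective (Polynomial ℚ) Fq)).2 Polynomial.X_ne_zero

lemma aux_one_sub (j : ℕ) : (1 - q * q ^ j) ≠ 0 := by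
  have h : (1 - q * q ^ j) = algebraMap (Polynomial ℚ) Fq (1 - Polynomial.X * Polynomial.X ^ j) := by
    simp [q]
  rw [h, map_ne_zero_iff _ (IsFractionRing.injective (Polynomial ℚ) Fq)]
  intro h0
  have := congrArg (Polynomial.eval 0) h0
  simp at this

lemma aux_poch (n : ℕ) : qPoch q q n ≠ 0 := by
  unfold qPoch
  exact Finset.prod_ne_zero_iff.2 fun j _ => aux_one_sub j

lemma aux_poch_succ (n : ℕ) : qPoch q q (n+1) = qPoch q q n * (1 - q * q ^ n) := by
  unfold qPoch
  rw [Finset.prod_range_succ]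

lemma aux_bin_zero (n : ℕ) : qBin q n 0 = 1 := by
  have := aux_poch n
  simp [qBin, qPoch] at *
  exact this

lemma aux_bin_self (n : ℕ) : qBin q n n = 1 := by
  have := aux_poch n
  simp [qBin, qPoch] at *
  exact this

lemma aux_bin_gt {n k : ℕ} (h : n < k) : qBin q n k = 0 := by
  simp [qBin, h]

lemma aux_bin_add (k d : ℕ) : qBin q (k + d) k = qPoch q q (k+d) / (qPoch q q k * qPoch q q d) := by
  simp [qBin]

lemma aux_pascal (a i : ℕ) :
    qBin q (a+1) (i+1) = qBin q a (i+1) + q ^ ((a:ℤ) - i) * qBin q a i := by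
  rcases lt_trichotomy a i with h | h | h
  · rw [aux_bin_gt (by omega), aux_bin_gt (by omega), aux_bin_gt (by omega)]; simp
  · subst h
    rw [aux_bin_self, aux_bin_self, aux_bin_gt (by omega)]; simp
  · obtain ⟨d, rfl⟩ := Nat.exists_eq_add_of_lt h
    have e1 : qBin q (i+d+1+1) (i+1) = qPoch q q (i+d+1+1) / (qPoch q q (i+1) * qPoch q q (d+1)) := by
      rw [show i+d+1+1 = (i+1)+(d+1) by omega, ← aux_bin_add]
    have e2 : qBin q (i+d+1) (i+1) = qPoch q q (i+d+1) / (qPoch q q (i+1) * qPoch q q d) := by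
      rw [show i+d+1 = (i+1)+d by omega, ← aux_bin_add]
    have e3 : qBin q (i+d+1) i = qPoch q q (i+d+1) / (qPoch q q i * qPoch q q (d+1)) := by
      rw [add_assoc, ← aux_bin_add]
    have e4 : ((i+d+1 : ℕ):ℤ) - i = ((d+1 : ℕ) : ℤ) := by push_cast; ring
    rw [e1, e2, e3, e4, zpow_natCast, aux_poch_succ (i+d+1), aux_poch_succ i, aux_poch_succ d]
    have h1 := aux_poch i
    have h2 := aux_poch d
    have h3 := aux_one_sub i
    have h4 := aux_one_sub d
    field_simp
    ring

lemma aux_vander (a b c : ℕ) :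
    ∑ i ∈ range (c+1), q ^ ((i:ℤ) * (b + i - c)) * qBin q a i * qBin q b (c - i)
      = qBin q (a+b) c := by
  induction a generalizing c with
  | zero =>
    rw [Finset.sum_range_succ']
    rw [Finset.sum_eq_zero]
    · simp [aux_bin_zero]
    · intro i _
      rw [aux_bin_gt (Nat.succ_pos i)]; simp
  | succ a ih =>
    cases c with
    | zero => simp [aux_bin_zero]
    | succ c =>
      rw [show a + 1 + b = (a+b)+1 by omega, aux_pascal, ← ih, ← ih, Finset.sum_range_succ',
        Finset.sum_range_succ' _ (c+1), Finset.mul_sum, add_right_comm, ← Finset.sum_add_distrib]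
      congr 1
      · apply Finset.sum_congr rfl
        intro i _
        rw [aux_pascal, Nat.add_sub_add_right]
        have : q ^ (((i+1:ℕ):ℤ) * (b + (i+1:ℕ) - (c+1:ℕ))) * q ^ ((a:ℤ) - i)
            = q ^ (((a+b:ℕ):ℤ) - c) * q ^ ((i:ℤ) * (b + i - c)) := by
          rw [← zpow_add₀ aux_q_ne, ← zpow_add₀ aux_q_ne]
          congr 1
          push_cast; ring
        linear_combination (qBin q a i * qBin q b (c-i)) * this
      · simp [aux_bin_zero]

lemma aux_rothe (k : ℕ) :
    qPoch q (-q) k = ∑ j ∈ range (k+1), q ^ (j * (j+1) / 2) * qBin q k j := by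
  induction k with
  | zero => simp [qPoch, aux_bin_zero]
  | succ k ih =>
    have h : qPoch q (-q) (k+1) = qPoch q (-q) k * (1 + q ^ (k+1)) := by
      unfold qPoch
      rw [Finset.prod_range_succ]; ring
    have h2 : ∑ j ∈ range (k+1), q ^ (j * (j+1) / 2) * qBin q k j
        = ∑ j ∈ range (k+1), q ^ ((j+1) * (j+1+1) / 2) * qBin q k (j+1) + 1 := by
      have := Finset.sum_range_succ' (fun j => q ^ (j * (j+1) / 2) * qBin q k j) (k+1)
      rw [Finset.sum_range_succ, aux_bin_gt (Nat.lt_succ_self k)] at this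
      simpa [aux_bin_zero] using this
    rw [h, mul_add, mul_one, ih, Finset.sum_range_succ' _ (k+1)]
    nth_rewrite 1 [h2]
    rw [add_right_comm, Finset.sum_mul, ← Finset.sum_add_distrib]
    congr 1
    · apply Finset.sum_congr rfl
      intro j _
      rw [aux_pascal]
      have : q ^ ((j+1) * (j+1+1) / 2) * q ^ ((k:ℤ) - j) = q ^ (j * (j+1) / 2) * q ^ (k+1) := by
        rw [← zpow_natCast, ← zpow_natCast q (j * (j+1) / 2), ← zpow_natCast q (k+1),
          ← zpow_add₀ aux_q_ne, ← zpow_add₀ aux_q_ne]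
        congr 1
        have : (j+1) * (j+1+1) / 2 = j * (j+1) / 2 + (j + 1) := by
          rw [show (j+1) * (j+1+1) = j * (j+1) + (j+1) * 2 by ring,
            Nat.add_mul_div_right _ _ (by norm_num)]
        rw [this]; push_cast; ring
      linear_combination (-qBin q k j) * this
    · simp [aux_bin_zero]

lemma aux_rev {m k j : ℕ} (hk : k ≤ m) (hj : j ≤ m) :
    qBin q m k * qBin q k j = qBin q m j * qBin q (m-j) (m-k) := by
  by_cases h : j ≤ k
  · obtain ⟨d, rfl⟩ := Nat.exists_eq_add_of_le h
    obtain ⟨e, rfl⟩ := Nat.exists_eq_add_of_le hk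
    have e1 : qBin q (j+d+e) j = qPoch q q (j+d+e) / (qPoch q q j * qPoch q q (d+e)) := by
      rw [add_assoc, ← aux_bin_add]
    rw [show j+d+e-j = e+d by omega, show j+d+e-(j+d) = e by omega, e1, aux_bin_add,
      aux_bin_add, aux_bin_add, add_comm e d]
    have h1 := aux_poch j
    have h2 := aux_poch d
    have h3 := aux_poch e
    have h4 := aux_poch (d+e)
    have h5 := aux_poch (j+d)
    field_simp
  · rw [aux_bin_gt (show k < j by omega), aux_bin_gt (show m - j < m - k by omega)]; simp

theorem Dstar_eq (m n : ℕ) :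
    Dstar q n m = ∑ k ∈ Finset.range (m + 1),
      q ^ (((m : ℤ) - k) * ((n : ℤ) - k)) * qBin q m k * qBin q n k * qPoch q (-q) k := by
  have h1 : ∀ k ∈ range (m+1), qPoch q (-q) k
      = ∑ j ∈ range (m+1), q ^ (j * (j+1) / 2) * qBin q k j := by
    intro k hk
    rw [aux_rothe]
    apply Finset.sum_subset
    · intro x hx; simp at *; omega
    · intro x _ hx
      rw [aux_bin_gt (by simp at hx; omega)]; simp
  rw [Finset.sum_congr rfl fun k hk => by rw [h1 k hk, Finset.mul_sum], Finset.sum_comm]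
  unfold Dstar
  apply Finset.sum_congr rfl
  intro j hj
  have hj' : j ≤ m := by simp at hj; omega
  rw [show m + n - j = (m - j) + n by omega, ← aux_vander, ← Finset.sum_range_reflect,
    Finset.mul_sum]
  apply Finset.sum_congr rfl
  intro k hk
  have hk' : k ≤ m := by simp at hk; omega
  rw [show m + 1 - 1 - k = m - k by omega, show m - (m - k) = k by omega, Nat.cast_sub hk',
    show (n:ℤ) + ((m:ℤ) - k) - m = n - k by ring]
  linear_combination (-(q ^ (((m : ℤ) - k) * ((n : ℤ) - k)) * qBin q n k * q ^ (j * (j+1) / 2)))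
    * aux_rev hk' hj'
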